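/- arXiv:2309.00093 — 2 statements merged into one kernel-verified Lean document; each statement's English description precedes it below -/
import Mathlib

section
/- Let c > 0. Then ∫₀¹ ∫₀ˣ K_c(x,y)² dy dx ≤ (cπ/8)·erfi(√(c/2))·erf(√(c/2)), and likewise ∫₀¹ ∫₀ˣ L_c(x,y)² dy dx ≤ (cπ/8)·erfi(√(c/2))·erf(√(c/2)). Equivalently, the L² norms of K_c and of L_c over the triangle {0 ≤ y ≤ x ≤ 1} are each bounded by √(cπ/8)·(erfi(√(c/2))·erf(√(c/2)))^{1/2}. -/
/-- The backstepping kernel `K_c`. -/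
noncomputable def Kker (c x y : ℝ) : ℝ :=
  -(c / 2) * x * ∑' m : ℕ, (c * (x ^ 2 - y ^ 2) / 4) ^ m /
    ((Nat.factorial m : ℝ) * (Nat.factorial (m + 1) : ℝ))

/-- The inverse backstepping kernel `L_c`. -/
noncomputable def Lker (c x y : ℝ) : ℝ :=
  -(c / 2) * x * ∑' m : ℕ, (-1 : ℝ) ^ m * (c * (x ^ 2 - y ^ 2) / 4) ^ m /
    ((Nat.factorial m : ℝ) * (Nat.factorial (m + 1) : ℝ))

/-- The error function `erf(x) = (2/√π)·∫₀ˣ e^{−t²} dt`. -/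
noncomputable def erf (x : ℝ) : ℝ :=
  (2 / Real.sqrt Real.pi) * ∫ t in (0:ℝ)..x, Real.exp (-(t ^ 2))

/-- The imaginary error function `erfi(x) = (2/√π)·∫₀ˣ e^{t²} dt`. -/
noncomputable def erfi (x : ℝ) : ℝ :=
  (2 / Real.sqrt Real.pi) * ∫ t in (0:ℝ)..x, Real.exp (t ^ 2)

open MeasureTheory in
theorem intervalIntegral_le_of_nonneg_of_le {f g : ℝ → ℝ} {a b : ℝ} (hab : a ≤ b)
    (hg : IntervalIntegrable g volume a b) (hf : ∀ x ∈ Set.Ioc a b, 0 ≤ f x)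
    (hfg : ∀ x ∈ Set.Ioc a b, f x ≤ g x) :
    ∫ x in a..b, f x ≤ ∫ x in a..b, g x := by
  rw [intervalIntegral.integral_of_le hab, intervalIntegral.integral_of_le hab]
  refine integral_mono_of_nonneg ?_ ((intervalIntegrable_iff_integrableOn_Ioc_of_le hab).1 hg) ?_
  · filter_upwards [ae_restrict_mem measurableSet_Ioc] with x hx using hf x hx
  · filter_upwards [ae_restrict_mem measurableSet_Ioc] with x hx using hfg x hx

theorem two_pow_le_factorial_succ (m : ℕ) : 2 ^ m ≤ (m + 1).factorial := by
  induction m with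
  | zero => simp
  | succ k ih =>
    rw [Nat.factorial_succ, pow_succ, mul_comm]
    exact Nat.mul_le_mul (by omega) ih

/-- A power series dominated by `∑ zᵐ / (m! (m+1)!)` is bounded by `exp (z / 2)`. -/
theorem abs_tsum_le_exp_half {z : ℝ} {a : ℕ → ℝ}
    (ha : ∀ m, |a m| ≤ z ^ m / ((m.factorial : ℝ) * ((m + 1).factorial : ℝ))) (hz : 0 ≤ z) :
    |∑' m, a m| ≤ Real.exp (z / 2) := by
  have hsum : HasSum (fun m : ℕ => (z / 2) ^ m / (m.factorial : ℝ)) (Real.exp (z / 2)) := by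
    rw [Real.exp_eq_exp_ℝ]
    exact NormedSpace.expSeries_div_hasSum_exp (z / 2)
  refine tsum_of_norm_bounded (f := a) hsum fun m => (ha m).trans ?_
  have h : (2 : ℝ) ^ m ≤ ((m + 1).factorial : ℝ) := by
    exact_mod_cast two_pow_le_factorial_succ m
  rw [div_pow, div_div, mul_comm ((2 : ℝ) ^ m)]
  gcongr

theorem abs_neg_half_mul_mul_le {c x y s : ℝ} (hc : 0 < c) (hx : 0 ≤ x) (hx1 : x ≤ 1)
    (hs : |s| ≤ Real.exp (c * (x ^ 2 - y ^ 2) / 4 / 2)) (hz : 0 ≤ c * (x ^ 2 - y ^ 2) / 4) :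
    |-(c / 2) * x * s| ≤ c / 2 * Real.exp (c * (x ^ 2 - y ^ 2) / 4) := by
  rw [abs_mul, abs_mul, abs_neg, abs_of_pos (half_pos hc), abs_of_nonneg hx]
  have hs' : |s| ≤ Real.exp (c * (x ^ 2 - y ^ 2) / 4) :=
    hs.trans (Real.exp_le_exp.2 (by linarith))
  calc c / 2 * x * |s| ≤ c / 2 * 1 * Real.exp (c * (x ^ 2 - y ^ 2) / 4) := by gcongr
    _ = _ := by rw [mul_one]

theorem mul_sq_sub_sq_div_four_nonneg {c x y : ℝ} (hc : 0 < c) (hy : 0 ≤ y) (hyx : y ≤ x) :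
    0 ≤ c * (x ^ 2 - y ^ 2) / 4 := by
  have : y ^ 2 ≤ x ^ 2 := by gcongr
  have : 0 ≤ x ^ 2 - y ^ 2 := sub_nonneg.2 this
  positivity

theorem abs_Kker_le {c x y : ℝ} (hc : 0 < c) (hy : 0 ≤ y) (hyx : y ≤ x) (hx1 : x ≤ 1) :
    |Kker c x y| ≤ c / 2 * Real.exp (c * (x ^ 2 - y ^ 2) / 4) := by
  have hz := mul_sq_sub_sq_div_four_nonneg hc hy hyx
  refine abs_neg_half_mul_mul_le hc (hy.trans hyx) hx1 (abs_tsum_le_exp_half (fun m => ?_) hz) hz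
  exact (abs_of_nonneg (by positivity)).le

theorem abs_Lker_le {c x y : ℝ} (hc : 0 < c) (hy : 0 ≤ y) (hyx : y ≤ x) (hx1 : x ≤ 1) :
    |Lker c x y| ≤ c / 2 * Real.exp (c * (x ^ 2 - y ^ 2) / 4) := by
  have hz := mul_sq_sub_sq_div_four_nonneg hc hy hyx
  refine abs_neg_half_mul_mul_le hc (hy.trans hyx) hx1 (abs_tsum_le_exp_half (fun m => ?_) hz) hz
  rw [mul_div_assoc, abs_mul, abs_pow, abs_neg, abs_one, one_pow, one_mul]
  exact (abs_of_nonneg (by positivity)).le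

/-- Rescaling the error functions to integrals over the unit interval. -/
theorem mul_erfi_mul_erf_eq {c : ℝ} (hc : 0 < c) :
    c * Real.pi / 8 * erfi (Real.sqrt (c / 2)) * erf (Real.sqrt (c / 2)) =
      c ^ 2 / 4 * ((∫ x in (0:ℝ)..1, Real.exp (c * x ^ 2 / 2)) *
        ∫ y in (0:ℝ)..1, Real.exp (-(c * y ^ 2 / 2))) := by
  have ha : Real.sqrt (c / 2) ^ 2 = c / 2 := Real.sq_sqrt (half_pos hc).le
  have key (f : ℝ → ℝ) : ∫ t in (0:ℝ)..Real.sqrt (c / 2), f t =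
      Real.sqrt (c / 2) * ∫ x in (0:ℝ)..1, f (Real.sqrt (c / 2) * x) := by
    rw [intervalIntegral.mul_integral_comp_mul_left, mul_zero, mul_one]
  have hexp (x : ℝ) : (Real.sqrt (c / 2) * x) ^ 2 = c * x ^ 2 / 2 := by
    rw [mul_pow, ha]; ring
  unfold erfi erf
  rw [key, key fun t => Real.exp (-(t ^ 2))]
  simp only [hexp]
  generalize (∫ x in (0:ℝ)..1, Real.exp (c * x ^ 2 / 2)) = A
  generalize (∫ y in (0:ℝ)..1, Real.exp (-(c * y ^ 2 / 2))) = B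
  have hpi : Real.sqrt Real.pi ^ 2 = Real.pi := Real.sq_sqrt Real.pi_pos.le
  have hpi0 : Real.sqrt Real.pi ≠ 0 := (Real.sqrt_pos.2 Real.pi_pos).ne'
  calc _ = c * Real.pi / 8 * (4 / Real.sqrt Real.pi ^ 2) * Real.sqrt (c / 2) ^ 2 * (A * B) := by
        ring
    _ = _ := by
      rw [hpi, ha]
      field_simp [Real.pi_ne_zero]
      ring

theorem integral_sq_le_of_abs_le {c : ℝ} (hc : 0 < c) {F : ℝ → ℝ → ℝ}
    (hF : ∀ x y, 0 ≤ y → y ≤ x → x ≤ 1 →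
      |F x y| ≤ c / 2 * Real.exp (c * (x ^ 2 - y ^ 2) / 4)) :
    (∫ x in (0:ℝ)..1, ∫ y in (0:ℝ)..x, F x y ^ 2) ≤
      c * Real.pi / 8 * erfi (Real.sqrt (c / 2)) * erf (Real.sqrt (c / 2)) := by
  rw [mul_erfi_mul_erf_eq hc, ← intervalIntegral.integral_mul_const,
    ← intervalIntegral.integral_const_mul]
  refine intervalIntegral_le_of_nonneg_of_le zero_le_one
    (Continuous.intervalIntegrable (by fun_prop) _ _)
    (fun x hx => intervalIntegral.integral_nonneg hx.1.le fun _ _ => sq_nonneg _) fun x hx => ?_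
  set G : ℝ → ℝ := fun y => c ^ 2 / 4 * (Real.exp (c * x ^ 2 / 2) * Real.exp (-(c * y ^ 2 / 2)))
    with hG
  have hGc : Continuous G := by fun_prop
  calc ∫ y in (0:ℝ)..x, F x y ^ 2 ≤ ∫ y in (0:ℝ)..x, G y := by
        refine intervalIntegral_le_of_nonneg_of_le hx.1.le (hGc.intervalIntegrable _ _)
          (fun _ _ => sq_nonneg _) fun y hy => ?_
        rw [← sq_abs]
        refine (pow_le_pow_left₀ (abs_nonneg _) (hF x y hy.1.le hy.2 hx.2) 2).trans_eq ?_
        simp only [hG]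
        rw [mul_pow, ← Real.exp_nat_mul, ← Real.exp_add]
        congr 1
        · ring
        · congr 1
          push_cast
          ring
    _ ≤ ∫ y in (0:ℝ)..1, G y :=
        intervalIntegral.integral_mono_interval le_rfl hx.1.le hx.2
          (Filter.Eventually.of_forall fun y => by simp only [hG, Pi.zero_apply]; positivity)
          (hGc.intervalIntegrable _ _)
    _ = _ := by
        rw [hG, intervalIntegral.integral_const_mul, intervalIntegral.integral_const_mul]

/-- Lemma 7: L² bounds on the backstepping kernels over the
triangle {0 ≤ y ≤ x ≤ 1}. -/
theorem kernel_L2_bounds (c : ℝ) (hc : c > 0) :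
    ((∫ x in (0:ℝ)..1, ∫ y in (0:ℝ)..x, (Kker c x y) ^ 2) ≤
      (c * Real.pi / 8) * erfi (Real.sqrt (c / 2)) * erf (Real.sqrt (c / 2)) ∧
     (∫ x in (0:ℝ)..1, ∫ y in (0:ℝ)..x, (Lker c x y) ^ 2) ≤
      (c * Real.pi / 8) * erfi (Real.sqrt (c / 2)) * erf (Real.sqrt (c / 2))) ∧
    (Real.sqrt (∫ x in (0:ℝ)..1, ∫ y in (0:ℝ)..x, (Kker c x y) ^ 2) ≤
      Real.sqrt (c * Real.pi / 8) *
        (erfi (Real.sqrt (c / 2)) * erf (Real.sqrt (c / 2))) ^ ((1:ℝ)/2) ∧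
     Real.sqrt (∫ x in (0:ℝ)..1, ∫ y in (0:ℝ)..x, (Lker c x y) ^ 2) ≤
      Real.sqrt (c * Real.pi / 8) *
        (erfi (Real.sqrt (c / 2)) * erf (Real.sqrt (c / 2))) ^ ((1:ℝ)/2)) := by
  have hK := integral_sq_le_of_abs_le hc fun x y (hy : 0 ≤ y) hyx hx1 => abs_Kker_le hc hy hyx hx1
  have hL := integral_sq_le_of_abs_le hc fun x y (hy : 0 ≤ y) hyx hx1 => abs_Lker_le hc hy hyx hx1
  have hsqrt : Real.sqrt (c * Real.pi / 8 * erfi (Real.sqrt (c / 2)) * erf (Real.sqrt (c / 2))) =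
      Real.sqrt (c * Real.pi / 8) *
        (erfi (Real.sqrt (c / 2)) * erf (Real.sqrt (c / 2))) ^ ((1:ℝ)/2) := by
    have hpi := Real.pi_pos
    rw [mul_assoc, Real.sqrt_mul (by positivity), Real.sqrt_eq_rpow (erfi _ * _)]
  refine ⟨⟨hK, hL⟩, ?_, ?_⟩
  · exact (Real.sqrt_le_sqrt hK).trans_eq hsqrt
  · exact (Real.sqrt_le_sqrt hL).trans_eq hsqrt
end

section
/- Let ρ, α, β ∈ ℝ, γ > 0, c₂ > 0; set K = K_{c₂}, L = L_{c₂}, ‖K‖ = (∫₀¹∫₀ˣ K² dy dx)^{1/2}, ‖L‖ = (∫₀¹∫₀ˣ L² dy dx)^{1/2}. Suppose c₂ + ρ > (|αβ|/γ)·[1 + √(c₂π/8)·(erfi(√(c₂/2)))^{1/2}·(erf(√(c₂/2)))^{1/2}]². Suppose w, v : [0,1] × [0,∞) → ℝ are a classical solution (continuous; twice continuously differentiable in x with jointly continuous spatial derivatives; w continuously differentiable in t) of: w_t = w_xx − ρw + αv; 0 = v_xx − γv + βw; w_x(0,t) = 0; w_x(1,t) = ∫₀¹ ∂ₓK(1,y)w(y,t)dy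 + K(1,1)w(1,t); v_x(0,t) = v_x(1,t) = 0. Then c₃ := (c₂ + ρ) − (|αβ|/γ)(1 + ‖L‖)(1 + ‖K‖) > 0, and for all t ≥ 0: ∫₀¹ w(x,t)² dx ≤ (1 + ‖L‖)²·(1 + ‖K‖)²·e^{−2c₃t}·∫₀¹ w(x,0)² dx. -/
/-- L² norm of a kernel over the triangle {0 ≤ y ≤ x ≤ 1}. -/
noncomputable def kerNorm (f : ℝ → ℝ → ℝ) : ℝ :=
  Real.sqrt (∫ x in (0:ℝ)..1, ∫ y in (0:ℝ)..x, (f x y) ^ 2)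

section

open Set Filter Topology MeasureTheory intervalIntegral

/-- The entire function `∑ sᵐ / (m! (m + k)!)`, a rescaled modified Bessel function of order `k`. -/
noncomputable def besselSeries (k : ℕ) (s : ℝ) : ℝ :=
  ∑' m : ℕ, s ^ m / ((m.factorial : ℝ) * ((m + k).factorial : ℝ))

lemma norm_besselSeries_term_le (k m : ℕ) {s R : ℝ} (hs : |s| ≤ R) :
    ‖s ^ m / ((m.factorial : ℝ) * ((m + k).factorial : ℝ))‖ ≤ R ^ m / (m.factorial : ℝ) := by
  have h1 : (1 : ℝ) ≤ ((m + k).factorial : ℝ) := by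
    exact_mod_cast Nat.one_le_iff_ne_zero.mpr (Nat.factorial_ne_zero _)
  have h0 : (0 : ℝ) < (m.factorial : ℝ) := by positivity
  rw [norm_div, norm_pow, Real.norm_eq_abs, Real.norm_of_nonneg (by positivity)]
  gcongr
  · exact pow_nonneg ((abs_nonneg s).trans hs) m
  · exact le_mul_of_one_le_right h0.le h1

lemma summable_besselSeries (k : ℕ) (s : ℝ) :
    Summable fun m : ℕ => s ^ m / ((m.factorial : ℝ) * ((m + k).factorial : ℝ)) :=
  Summable.of_norm_bounded (Real.summable_pow_div_factorial |s|)
    fun m => norm_besselSeries_term_le k m le_rfl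

lemma abs_besselSeries_le_exp (k : ℕ) (s : ℝ) : |besselSeries k s| ≤ Real.exp |s| := by
  have h := tsum_of_norm_bounded (Real.summable_pow_div_factorial |s|).hasSum
    fun m => norm_besselSeries_term_le k m le_rfl
  rwa [Real.exp_eq_exp_ℝ, NormedSpace.exp_eq_tsum_div]

lemma hasDerivAt_besselSeries (k : ℕ) (s : ℝ) :
    HasDerivAt (besselSeries k) (besselSeries (k + 1) s) s := by
  set R := |s| + 1
  have hR : 0 ≤ R := by positivity
  have hterm : ∀ (m : ℕ) (y : ℝ), ((m + 1 : ℕ) : ℝ) * y ^ m /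
      (((m + 1).factorial : ℝ) * ((m + 1 + k).factorial : ℝ)) =
      y ^ m / ((m.factorial : ℝ) * ((m + (k + 1)).factorial : ℝ)) := by
    intro m y
    rw [Nat.factorial_succ m, show m + 1 + k = m + (k + 1) by ring]
    push_cast
    field_simp
  have h := hasDerivAt_tsum_of_isPreconnected
    (g := fun (m : ℕ) (y : ℝ) => y ^ m / ((m.factorial : ℝ) * ((m + k).factorial : ℝ)))
    (g' := fun (m : ℕ) (y : ℝ) =>
      (m : ℝ) * y ^ (m - 1) / ((m.factorial : ℝ) * ((m + k).factorial : ℝ)))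
    (u := fun m : ℕ => (m : ℝ) * R ^ (m - 1) / (m.factorial : ℝ))
    (t := Metric.ball 0 R) (y₀ := s) (y := s) ?_ Metric.isOpen_ball
    (convex_ball _ _).isPreconnected ?_ ?_ ?_ (summable_besselSeries k s) ?_
  · refine h.congr_deriv ?_
    rw [tsum_eq_zero_add']
    · simp only [Nat.add_sub_cancel, hterm]
      simp [besselSeries]
    · exact (summable_besselSeries (k + 1) s).congr fun m => (hterm m s).symm
  · rw [← summable_nat_add_iff 1]
    refine (Real.summable_pow_div_factorial R).congr fun m => ?_
    rw [Nat.factorial_succ m]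
    push_cast
    field_simp
  · intro m y _
    exact (hasDerivAt_pow m y).div_const _
  · intro m y hy
    have hy' : |y| ≤ R := by simpa using (Metric.mem_ball.mp hy).le
    have h1 : (1 : ℝ) ≤ ((m + k).factorial : ℝ) := by
      exact_mod_cast Nat.one_le_iff_ne_zero.mpr (Nat.factorial_ne_zero _)
    have h0 : (0 : ℝ) < (m.factorial : ℝ) := by positivity
    rw [norm_div, norm_mul, norm_pow, Real.norm_eq_abs, Real.norm_eq_abs,
      Real.norm_of_nonneg (by positivity : (0 : ℝ) ≤ m.factorial * (m + k).factorial),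
      abs_of_nonneg (Nat.cast_nonneg m)]
    gcongr
    exact le_mul_of_one_le_right h0.le h1
  · simp [R]
  · simp [R]

@[fun_prop]
lemma continuous_besselSeries (k : ℕ) : Continuous (besselSeries k) :=
  continuous_iff_continuousAt.mpr fun s => (hasDerivAt_besselSeries k s).continuousAt

lemma besselSeries_recurrence (k : ℕ) (s : ℝ) :
    s * besselSeries (k + 2) s + (k + 1) * besselSeries (k + 1) s = besselSeries k s := by
  have h2 : s * besselSeries (k + 2) s = ∑' m : ℕ,
      (m : ℝ) * (s ^ m / ((m.factorial : ℝ) * ((m + (k + 1)).factorial : ℝ))) := by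
    have hterm : ∀ m : ℕ, ((m + 1 : ℕ) : ℝ) *
        (s ^ (m + 1) / (((m + 1).factorial : ℝ) * ((m + 1 + (k + 1)).factorial : ℝ))) =
        s * (s ^ m / ((m.factorial : ℝ) * ((m + (k + 2)).factorial : ℝ))) := by
      intro m
      rw [Nat.factorial_succ m, show m + 1 + (k + 1) = m + (k + 2) by ring]
      push_cast
      field_simp
      ring
    rw [tsum_eq_zero_add']
    · simp only [hterm, besselSeries]
      rw [tsum_mul_left]
      simp
    · simp only [hterm]
      exact (summable_besselSeries (k + 2) s).mul_left s
  have hterm : ∀ m : ℕ,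
      (m : ℝ) * (s ^ m / ((m.factorial : ℝ) * ((m + (k + 1)).factorial : ℝ))) =
      s ^ m / ((m.factorial : ℝ) * ((m + k).factorial : ℝ)) -
        (k + 1) * (s ^ m / ((m.factorial : ℝ) * ((m + (k + 1)).factorial : ℝ))) := by
    intro m
    rw [show m + (k + 1) = m + k + 1 by ring, Nat.factorial_succ (m + k)]
    push_cast
    field_simp
    ring
  rw [h2]
  simp only [hterm]
  rw [Summable.tsum_sub (summable_besselSeries k s)
    ((summable_besselSeries (k + 1) s).mul_left _), tsum_mul_left]
  simp [besselSeries]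

lemma besselSeries_one_zero : besselSeries 1 0 = 1 := by
  rw [besselSeries, tsum_eq_single 0]
  · simp
  · intro m hm
    simp [hm]

/-- Convolution identity behind the inversion of the backstepping transformation. -/
lemma integral_besselSeries_mul (S : ℝ) :
    ∫ τ in (0 : ℝ)..S, besselSeries 1 (τ - S) * besselSeries 1 τ =
      besselSeries 1 S - besselSeries 1 (-S) := by
  rcases eq_or_ne S 0 with rfl | hS
  · simp
  have hrec : ∀ s, besselSeries 0 s = s * besselSeries 2 s + besselSeries 1 s := by
    intro s
    have := besselSeries_recurrence 0 s
    norm_num at this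
    linarith
  have hP : ∀ a : ℝ, HasDerivAt (fun a => a * besselSeries 1 a) (besselSeries 0 a) a := by
    intro a
    refine ((hasDerivAt_id a).mul (hasDerivAt_besselSeries 1 a)).congr_deriv ?_
    simp only [id, hrec a]
    ring
  have hsub : ∀ τ : ℝ, HasDerivAt (fun τ => τ - S) 1 τ := fun τ => (hasDerivAt_id τ).sub_const S
  have hd : ∀ τ : ℝ, HasDerivAt (fun τ => τ * besselSeries 1 τ * besselSeries 0 (τ - S) -
      besselSeries 0 τ * ((τ - S) * besselSeries 1 (τ - S)))
      (S * (besselSeries 1 (τ - S) * besselSeries 1 τ)) τ := by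
    intro τ
    have h0 := (hasDerivAt_besselSeries 0 (τ - S)).comp τ (hsub τ)
    have h1 := (hP (τ - S)).comp τ (hsub τ)
    refine (((hP τ).mul h0).sub ((hasDerivAt_besselSeries 0 τ).mul h1)).congr_deriv ?_
    simp only [Function.comp_apply, zero_add]
    ring
  have hint := integral_eq_sub_of_hasDerivAt (a := 0) (b := S) (fun τ _ => hd τ)
    (Continuous.intervalIntegrable (by fun_prop) _ _)
  rw [intervalIntegral.integral_const_mul] at hint
  have h00 : besselSeries 0 0 = 1 := by rw [hrec, besselSeries_one_zero]; simp
  simp only [sub_self, zero_mul, mul_zero, sub_zero, zero_sub, h00] at hint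
  refine mul_left_cancel₀ hS ?_
  rw [hint]
  ring

lemma hasDerivAt_integral_of_continuous {F F' : ℝ → ℝ → ℝ} {a b t₀ : ℝ} {U : Set ℝ}
    (hU : U ∈ 𝓝 t₀) (hF : Continuous fun p : ℝ × ℝ => F p.1 p.2)
    (hF' : Continuous fun p : ℝ × ℝ => F' p.1 p.2)
    (hd : ∀ x ∈ uIcc a b, ∀ t ∈ U, HasDerivAt (fun t => F t x) (F' t x) t) :
    HasDerivAt (fun t => ∫ x in a..b, F t x) (∫ x in a..b, F' t₀ x) t₀ := by
  obtain ⟨ε, hε, hball⟩ := Metric.mem_nhds_iff.mp hU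
  obtain ⟨C, hC⟩ := ((isCompact_closedBall t₀ (ε / 2)).prod
    (isCompact_uIcc (a := a) (b := b))).exists_bound_of_continuousOn hF'.continuousOn
  have hslice : ∀ {G : ℝ → ℝ → ℝ}, (Continuous fun p : ℝ × ℝ => G p.1 p.2) →
      ∀ t, Continuous (G t) := fun hG t => hG.comp (by fun_prop : Continuous fun x => (t, x))
  refine (hasDerivAt_integral_of_dominated_loc_of_deriv_le (F := F) (F' := F')
    (bound := fun _ => C) (Metric.closedBall_mem_nhds t₀ (half_pos hε))
    (Eventually.of_forall fun t => (hslice hF t).aestronglyMeasurable)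
    ((hslice hF t₀).intervalIntegrable _ _) (hslice hF' t₀).aestronglyMeasurable
    (Eventually.of_forall fun x hx t ht => hC (t, x) ⟨ht, uIoc_subset_uIcc hx⟩)
    intervalIntegrable_const
    (Eventually.of_forall fun x hx t ht => hd x (uIoc_subset_uIcc hx) t
      (hball (Metric.closedBall_subset_ball (half_lt_self hε) ht)))).2

/-- The Leibniz rule for an integral with variable upper limit. -/
lemma hasDerivAt_integral_upper {F F' : ℝ → ℝ → ℝ}
    (hF : Continuous fun p : ℝ × ℝ => F p.1 p.2)
    (hF' : Continuous fun p : ℝ × ℝ => F' p.1 p.2)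
    (hd : ∀ x y, HasDerivAt (fun x => F x y) (F' x y) x) (x₀ : ℝ) :
    HasDerivAt (fun x => ∫ y in (0 : ℝ)..x, F x y)
      (F x₀ x₀ + ∫ y in (0 : ℝ)..x₀, F' x₀ y) x₀ := by
  have hslice : ∀ x, Continuous (F x) := fun x => hF.comp (by fun_prop : Continuous fun y => (x, y))
  have h1 : ∀ u x : ℝ, HasDerivAt (fun u => ∫ y in (0 : ℝ)..u, F x y) (F x u) u := fun u x =>
    (hslice x).integral_hasStrictDerivAt 0 u |>.hasDerivAt
  have h2 : ∀ u x : ℝ, HasDerivAt (fun x => ∫ y in (0 : ℝ)..u, F x y)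
      (∫ y in (0 : ℝ)..u, F' x y) x := fun u x =>
    hasDerivAt_integral_of_continuous univ_mem hF hF' fun y _ x _ => hd x y
  have hcont : Continuous fun p : ℝ × ℝ => ∫ y in (0 : ℝ)..p.1, F' p.2 y :=
    continuous_parametric_intervalIntegral_of_continuous
      (f := fun (p : ℝ × ℝ) y => F' p.2 y)
      (hF'.comp (by fun_prop : Continuous fun q : (ℝ × ℝ) × ℝ => (q.1.2, q.2))) continuous_fst
  have hs := (hasStrictFDerivAt_uncurry_coprod (𝕜 := ℝ) (u := (x₀, x₀))
    (f := fun u x => ∫ y in (0 : ℝ)..u, F x y)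
    (f₁ := fun u x => ContinuousLinearMap.toSpanSingleton ℝ (F x u))
    (f₂ := fun u x => ContinuousLinearMap.toSpanSingleton ℝ (∫ y in (0 : ℝ)..u, F' x y))
    (Eventually.of_forall fun p => (h1 p.1 p.2).hasFDerivAt)
    (Eventually.of_forall fun p => (h2 p.1 p.2).hasFDerivAt)
    ?_ ?_).hasFDerivAt
  · have hdiag : HasDerivAt (fun x : ℝ => (x, x)) (1, 1) x₀ :=
      (hasDerivAt_id x₀).prodMk (hasDerivAt_id x₀)
    refine (hs.comp_hasDerivAt (f := fun x => (x, x)) x₀ hdiag).congr_deriv ?_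
    simp [Function.HasUncurry.uncurry]
  · have := hF.comp (continuous_swap : Continuous (Prod.swap : ℝ × ℝ → ℝ × ℝ))
    exact ((ContinuousLinearMap.toSpanSingletonCLE (𝕜 := ℝ) (E := ℝ)).continuous.comp
      this).continuousAt
  · exact ((ContinuousLinearMap.toSpanSingletonCLE (𝕜 := ℝ) (E := ℝ)).continuous.comp
      hcont).continuousAt

/-- Fubini's theorem on a triangle. -/
lemma integral_integral_triangle {F : ℝ → ℝ → ℝ}
    (hF : Continuous fun p : ℝ × ℝ => F p.1 p.2) (x : ℝ) :
    ∫ y in (0 : ℝ)..x, ∫ ξ in (0 : ℝ)..y, F y ξ =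
      ∫ ξ in (0 : ℝ)..x, ∫ y in ξ..x, F y ξ := by
  have hcol : ∀ ξ, Continuous fun y => F y ξ :=
    fun ξ => hF.comp (by fun_prop : Continuous fun y => (y, ξ))
  have hA : Continuous fun y => ∫ ξ in (0 : ℝ)..y, F y ξ :=
    continuous_parametric_intervalIntegral_of_continuous (f := F) hF continuous_id
  have hsplit : ∀ x ξ : ℝ, ∫ y in ξ..x, F y ξ =
      (∫ y in (0 : ℝ)..x, F y ξ) - ∫ y in (0 : ℝ)..ξ, F y ξ := fun x ξ =>
    (integral_interval_sub_left ((hcol ξ).intervalIntegrable _ _)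
      ((hcol ξ).intervalIntegrable _ _)).symm
  have hF2 : Continuous (Function.uncurry fun (p : ℝ × ℝ) (y : ℝ) => F y p.2) :=
    hF.comp (by fun_prop : Continuous fun q : (ℝ × ℝ) × ℝ => (q.2, q.1.2))
  have hB : Continuous fun p : ℝ × ℝ => ∫ y in p.2..p.1, F y p.2 := by
    simp only [hsplit]
    exact (continuous_parametric_intervalIntegral_of_continuous hF2 continuous_fst).sub
      (continuous_parametric_intervalIntegral_of_continuous hF2 continuous_snd)
  have hBd : ∀ x ξ : ℝ, HasDerivAt (fun x => ∫ y in ξ..x, F y ξ) (F x ξ) x := fun x ξ =>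
    ((hcol ξ).integral_hasStrictDerivAt ξ x).hasDerivAt
  have hd : ∀ x, HasDerivAt (fun x => (∫ y in (0 : ℝ)..x, ∫ ξ in (0 : ℝ)..y, F y ξ) -
      ∫ ξ in (0 : ℝ)..x, ∫ y in ξ..x, F y ξ) 0 x := by
    intro x
    refine (((hA.integral_hasStrictDerivAt 0 x).hasDerivAt).sub
      (hasDerivAt_integral_upper hB hF hBd x)).congr_deriv ?_
    simp
  have hconst := is_const_of_deriv_eq_zero (fun x => (hd x).differentiableAt)
    (fun x => (hd x).deriv) x 0
  simp only [integral_same, sub_self] at hconst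
  exact sub_eq_zero.mp hconst

lemma sq_integral_mul_le {f g : ℝ → ℝ} (hf : Continuous f) (hg : Continuous g) {a b : ℝ}
    (hab : a ≤ b) :
    (∫ x in a..b, f x * g x) ^ 2 ≤ (∫ x in a..b, f x ^ 2) * ∫ x in a..b, g x ^ 2 := by
  have h : ∀ s : ℝ, 0 ≤ (∫ x in a..b, f x ^ 2) * (s * s) + (2 * ∫ x in a..b, f x * g x) * s +
      ∫ x in a..b, g x ^ 2 := by
    intro s
    have hnn : 0 ≤ ∫ x in a..b, (s * f x + g x) ^ 2 :=
      integral_nonneg hab fun x _ => sq_nonneg _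
    have heq : ∫ x in a..b, (s * f x + g x) ^ 2 =
        ∫ x in a..b, (s * s) * f x ^ 2 + (2 * s) * (f x * g x) + g x ^ 2 :=
      integral_congr fun x _ => by ring
    rw [heq, intervalIntegral.integral_add (Continuous.intervalIntegrable (by fun_prop) _ _)
      (Continuous.intervalIntegrable (by fun_prop) _ _),
      intervalIntegral.integral_add (Continuous.intervalIntegrable (by fun_prop) _ _)
      (Continuous.intervalIntegrable (by fun_prop) _ _), intervalIntegral.integral_const_mul,
      intervalIntegral.integral_const_mul] at hnn
    linarith
  have := discrim_le_zero h
  rw [discrim] at this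
  linarith

/-- The `L²(0, 1)` norm. -/
noncomputable def unitNorm (f : ℝ → ℝ) : ℝ := √(∫ x in (0 : ℝ)..1, f x ^ 2)

lemma unitNorm_nonneg (f : ℝ → ℝ) : 0 ≤ unitNorm f := Real.sqrt_nonneg _

lemma sq_unitNorm (f : ℝ → ℝ) : unitNorm f ^ 2 = ∫ x in (0 : ℝ)..1, f x ^ 2 :=
  Real.sq_sqrt (integral_nonneg zero_le_one fun _ _ => sq_nonneg _)

lemma abs_integral_mul_le_unitNorm {f g : ℝ → ℝ} (hf : Continuous f) (hg : Continuous g) :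
    |∫ x in (0 : ℝ)..1, f x * g x| ≤ unitNorm f * unitNorm g := by
  refine abs_le_of_sq_le_sq ?_ (by unfold unitNorm; positivity)
  rw [mul_pow, sq_unitNorm, sq_unitNorm]
  exact sq_integral_mul_le hf hg zero_le_one

lemma unitNorm_add_le {f g : ℝ → ℝ} (hf : Continuous f) (hg : Continuous g) :
    unitNorm (fun x => f x + g x) ≤ unitNorm f + unitNorm g := by
  have hnn : 0 ≤ unitNorm f + unitNorm g := add_nonneg (unitNorm_nonneg f) (unitNorm_nonneg g)
  refine le_of_sq_le_sq ?_ hnn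
  have heq : ∫ x in (0 : ℝ)..1, (f x + g x) ^ 2 =
      ∫ x in (0 : ℝ)..1, f x ^ 2 + 2 * (f x * g x) + g x ^ 2 :=
    integral_congr fun x _ => by ring
  rw [sq_unitNorm, heq,
    intervalIntegral.integral_add (Continuous.intervalIntegrable (by fun_prop) _ _)
      (Continuous.intervalIntegrable (by fun_prop) _ _),
    intervalIntegral.integral_add (Continuous.intervalIntegrable (by fun_prop) _ _)
      (Continuous.intervalIntegrable (by fun_prop) _ _), intervalIntegral.integral_const_mul,
    ← sq_unitNorm f, ← sq_unitNorm g]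
  have := (le_abs_self _).trans (abs_integral_mul_le_unitNorm hf hg)
  linarith

lemma unitNorm_sub_le {f g : ℝ → ℝ} (hf : Continuous f) (hg : Continuous g) :
    unitNorm (fun x => f x - g x) ≤ unitNorm f + unitNorm g := by
  have h := unitNorm_add_le hf (g := fun x => -g x) hg.neg
  have h2 : unitNorm (fun x => -g x) = unitNorm g := by simp [unitNorm]
  simpa [← sub_eq_add_neg, h2] using h

lemma kerNorm_nonneg (k : ℝ → ℝ → ℝ) : 0 ≤ kerNorm k := Real.sqrt_nonneg _

lemma continuous_volterra {k : ℝ → ℝ → ℝ} {f : ℝ → ℝ}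
    (hk : Continuous fun p : ℝ × ℝ => k p.1 p.2) (hf : Continuous f) :
    Continuous fun x => ∫ y in (0 : ℝ)..x, k x y * f y :=
  continuous_parametric_intervalIntegral_of_continuous (f := fun x y => k x y * f y)
    (hk.mul (hf.comp continuous_snd)) continuous_id

lemma continuous_integral_sq {k : ℝ → ℝ → ℝ} (hk : Continuous fun p : ℝ × ℝ => k p.1 p.2) :
    Continuous fun x => ∫ y in (0 : ℝ)..x, k x y ^ 2 :=
  continuous_parametric_intervalIntegral_of_continuous (f := fun x y => k x y ^ 2)
    (show Continuous fun p : ℝ × ℝ => k p.1 p.2 ^ 2 by fun_prop) continuous_id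

lemma sq_kerNorm (k : ℝ → ℝ → ℝ) :
    kerNorm k ^ 2 = ∫ x in (0 : ℝ)..1, ∫ y in (0 : ℝ)..x, k x y ^ 2 :=
  Real.sq_sqrt (integral_nonneg zero_le_one fun _ hx =>
    integral_nonneg hx.1 fun _ _ => sq_nonneg _)

lemma unitNorm_volterra_le {k : ℝ → ℝ → ℝ} {f : ℝ → ℝ}
    (hk : Continuous fun p : ℝ × ℝ => k p.1 p.2) (hf : Continuous f) :
    unitNorm (fun x => ∫ y in (0 : ℝ)..x, k x y * f y) ≤ kerNorm k * unitNorm f := by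
  refine le_of_sq_le_sq ?_ (mul_nonneg (kerNorm_nonneg k) (unitNorm_nonneg f))
  have hk2 := continuous_integral_sq hk
  rw [mul_pow, sq_unitNorm, sq_unitNorm, sq_kerNorm, ← intervalIntegral.integral_mul_const]
  refine integral_mono_on zero_le_one
    (((continuous_volterra hk hf).pow 2).intervalIntegrable _ _)
    ((hk2.mul_const _).intervalIntegrable _ _) fun x hx => ?_
  have hkx : Continuous (k x) := hk.comp (by fun_prop : Continuous fun y => (x, y))
  refine (sq_integral_mul_le hkx hf hx.1).trans ?_
  refine mul_le_mul_of_nonneg_left ?_ (integral_nonneg hx.1 fun _ _ => sq_nonneg _)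
  exact integral_mono_interval le_rfl hx.1 hx.2 (Eventually.of_forall fun _ => sq_nonneg _)
    ((hf.pow 2).intervalIntegrable _ _)

lemma Kker_eq (c x y : ℝ) :
    Kker c x y = -(c / 2) * x * besselSeries 1 (c * (x ^ 2 - y ^ 2) / 4) := rfl

lemma Lker_eq (c x y : ℝ) :
    Lker c x y = -(c / 2) * x * besselSeries 1 (-(c * (x ^ 2 - y ^ 2) / 4)) := by
  simp only [Lker, besselSeries, ← mul_pow, neg_one_mul]

lemma continuous_Kker (c : ℝ) : Continuous fun p : ℝ × ℝ => Kker c p.1 p.2 := by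
  simp only [Kker_eq]
  fun_prop

lemma continuous_Lker (c : ℝ) : Continuous fun p : ℝ × ℝ => Lker c p.1 p.2 := by
  simp only [Lker_eq]
  fun_prop

/-- The Volterra kernels are inverse to each other. -/
lemma integral_Lker_mul_Kker (c x y : ℝ) :
    ∫ ξ in y..x, Lker c x ξ * Kker c ξ y = Lker c x y - Kker c x y := by
  set S := c * (x ^ 2 - y ^ 2) / 4 with hS
  have hd : ∀ ξ ∈ uIcc y x, HasDerivAt (fun ξ : ℝ => c * (ξ ^ 2 - y ^ 2) / 4) (c * ξ / 2) ξ := by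
    intro ξ _
    refine ((((hasDerivAt_pow 2 ξ).sub_const (y ^ 2)).const_mul c).div_const 4).congr_deriv ?_
    norm_num
    ring
  have hsub := integral_comp_mul_deriv (a := y) (b := x) hd (by fun_prop)
    (g := fun τ => besselSeries 1 (τ - S) * besselSeries 1 τ) (by fun_prop)
  rw [← hS, sub_self, mul_zero, zero_div, integral_besselSeries_mul] at hsub
  rw [Lker_eq, Kker_eq, ← hS, show -(c / 2) * x * besselSeries 1 (-S) -
    -(c / 2) * x * besselSeries 1 S = c / 2 * x * (besselSeries 1 S - besselSeries 1 (-S)) by ring,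
    ← hsub, ← intervalIntegral.integral_const_mul]
  refine integral_congr fun ξ _ => ?_
  simp only [Lker_eq, Kker_eq, Function.comp_apply]
  rw [show c * (ξ ^ 2 - y ^ 2) / 4 - S = -(c * (x ^ 2 - ξ ^ 2) / 4) by rw [hS]; ring]
  ring

lemma inverse_backstepping (c : ℝ) {f : ℝ → ℝ} (hf : Continuous f) (x : ℝ) :
    f x = (f x - ∫ y in (0 : ℝ)..x, Kker c x y * f y) +
      ∫ y in (0 : ℝ)..x, Lker c x y * (f y - ∫ ξ in (0 : ℝ)..y, Kker c y ξ * f ξ) := by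
  have hL : Continuous (Lker c x) :=
    (continuous_Lker c).comp (by fun_prop : Continuous fun y => (x, y))
  have hK : Continuous (Kker c x) :=
    (continuous_Kker c).comp (by fun_prop : Continuous fun y => (x, y))
  have hV := continuous_volterra (continuous_Kker c) hf
  have hF : Continuous fun p : ℝ × ℝ => Lker c x p.1 * (Kker c p.1 p.2 * f p.2) :=
    (hL.comp continuous_fst).mul ((continuous_Kker c).mul (hf.comp continuous_snd))
  have htri := integral_integral_triangle
    (F := fun y ξ => Lker c x y * (Kker c y ξ * f ξ)) hF x
  simp only [← mul_assoc, intervalIntegral.integral_mul_const,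
    integral_Lker_mul_Kker] at htri
  simp only [mul_sub, mul_assoc] at htri ⊢
  simp only [sub_mul] at htri
  rw [intervalIntegral.integral_sub (Continuous.intervalIntegrable (by fun_prop) _ _)
    (Continuous.intervalIntegrable (hL.fun_mul hV) _ _)]
  simp only [intervalIntegral.integral_const_mul] at htri
  rw [htri, intervalIntegral.integral_sub (Continuous.intervalIntegrable (by fun_prop) _ _)
    (Continuous.intervalIntegrable (by fun_prop) _ _)]
  ring

lemma kerNorm_le_of_abs_le {c : ℝ} {k : ℝ → ℝ → ℝ}
    (hk : Continuous fun p : ℝ × ℝ => k p.1 p.2)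
    (hb : ∀ x ∈ Icc (0 : ℝ) 1, ∀ y ∈ Icc 0 x,
      |k x y| ≤ c / 2 * Real.exp (c * (x ^ 2 - y ^ 2) / 4)) :
    kerNorm k ^ 2 ≤ c ^ 2 / 4 * ((∫ x in (0 : ℝ)..1, Real.exp (c / 2 * x ^ 2)) *
      ∫ y in (0 : ℝ)..1, Real.exp (-(c / 2 * y ^ 2))) := by
  have hk2 := continuous_integral_sq hk
  rw [sq_kerNorm, ← intervalIntegral.integral_mul_const, ← intervalIntegral.integral_const_mul]
  refine integral_mono_on zero_le_one (hk2.intervalIntegrable _ _)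
    (Continuous.intervalIntegrable (by fun_prop) _ _) fun x hx => ?_
  have hkx : Continuous (k x) := hk.comp (by fun_prop : Continuous fun y => (x, y))
  have hE : Continuous fun y : ℝ => c ^ 2 / 4 * (Real.exp (c / 2 * x ^ 2) *
      Real.exp (-(c / 2 * y ^ 2))) := by fun_prop
  calc ∫ y in (0 : ℝ)..x, k x y ^ 2
      ≤ ∫ y in (0 : ℝ)..x, c ^ 2 / 4 * (Real.exp (c / 2 * x ^ 2) *
          Real.exp (-(c / 2 * y ^ 2))) := by
        refine integral_mono_on hx.1 ((hkx.pow 2).intervalIntegrable _ _)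
          (hE.intervalIntegrable _ _) fun y hy => ?_
        have h := pow_le_pow_left₀ (abs_nonneg _) (hb x hx y hy) 2
        rw [sq_abs, mul_pow, ← Real.exp_nat_mul] at h
        rw [← Real.exp_add]
        refine h.trans_eq ?_
        rw [show ((2 : ℕ) : ℝ) * (c * (x ^ 2 - y ^ 2) / 4) = c / 2 * x ^ 2 + -(c / 2 * y ^ 2) by
          push_cast; ring]
        ring
    _ ≤ ∫ y in (0 : ℝ)..1, c ^ 2 / 4 * (Real.exp (c / 2 * x ^ 2) *
          Real.exp (-(c / 2 * y ^ 2))) :=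
        integral_mono_interval le_rfl hx.1 hx.2 (Eventually.of_forall fun _ => by positivity)
          (hE.intervalIntegrable _ _)
    _ = _ := by rw [intervalIntegral.integral_const_mul, intervalIntegral.integral_const_mul]

lemma erf_mul_erfi_eq {c : ℝ} (hc : 0 < c) :
    (√(c * Real.pi / 8) * erfi √(c / 2) ^ ((1 : ℝ) / 2) * erf √(c / 2) ^ ((1 : ℝ) / 2)) ^ 2 =
      c ^ 2 / 4 * ((∫ x in (0 : ℝ)..1, Real.exp (c / 2 * x ^ 2)) *
        ∫ y in (0 : ℝ)..1, Real.exp (-(c / 2 * y ^ 2))) := by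
  have hs : 0 < √(c / 2) := Real.sqrt_pos.mpr (by positivity)
  have hs2 : √(c / 2) ^ 2 = c / 2 := Real.sq_sqrt (by positivity)
  have hpi : √Real.pi ^ 2 = Real.pi := Real.sq_sqrt Real.pi_pos.le
  generalize √(c / 2) = r at hs hs2 ⊢
  have hI : ∫ t in (0 : ℝ)..r, Real.exp (t ^ 2) =
      r * ∫ x in (0 : ℝ)..1, Real.exp (c / 2 * x ^ 2) := by
    have h := smul_integral_comp_mul_left (a := 0) (b := 1) (fun t => Real.exp (t ^ 2)) r
    simpa [mul_pow, hs2] using h.symm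
  have hJ : ∫ t in (0 : ℝ)..r, Real.exp (-(t ^ 2)) =
      r * ∫ x in (0 : ℝ)..1, Real.exp (-(c / 2 * x ^ 2)) := by
    have h := smul_integral_comp_mul_left (a := 0) (b := 1) (fun t => Real.exp (-(t ^ 2))) r
    simpa [mul_pow, hs2] using h.symm
  have hInn : 0 ≤ ∫ x in (0 : ℝ)..1, Real.exp (c / 2 * x ^ 2) :=
    integral_nonneg zero_le_one fun _ _ => (Real.exp_pos _).le
  have hJnn : 0 ≤ ∫ x in (0 : ℝ)..1, Real.exp (-(c / 2 * x ^ 2)) :=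
    integral_nonneg zero_le_one fun _ _ => (Real.exp_pos _).le
  rw [erfi, erf, hI, hJ, ← Real.sqrt_eq_rpow, ← Real.sqrt_eq_rpow, mul_pow, mul_pow,
    Real.sq_sqrt (by positivity), Real.sq_sqrt (by positivity), Real.sq_sqrt (by positivity)]
  field_simp
  rw [hs2, hpi]
  field_simp
  ring

lemma kerNorm_le_erf_erfi {c : ℝ} (hc : 0 < c) {k : ℝ → ℝ → ℝ}
    (hk : Continuous fun p : ℝ × ℝ => k p.1 p.2)
    (hb : ∀ x ∈ Icc (0 : ℝ) 1, ∀ y ∈ Icc 0 x,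
      |k x y| ≤ c / 2 * Real.exp (c * (x ^ 2 - y ^ 2) / 4)) :
    kerNorm k ≤
      √(c * Real.pi / 8) * erfi √(c / 2) ^ ((1 : ℝ) / 2) * erf √(c / 2) ^ ((1 : ℝ) / 2) := by
  refine le_of_sq_le_sq ((kerNorm_le_of_abs_le hk hb).trans_eq (erf_mul_erfi_eq hc).symm) ?_
  have hI : 0 ≤ erfi √(c / 2) := mul_nonneg (by positivity)
    (integral_nonneg (Real.sqrt_nonneg _) fun _ _ => (Real.exp_pos _).le)
  have hJ : 0 ≤ erf √(c / 2) := mul_nonneg (by positivity)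
    (integral_nonneg (Real.sqrt_nonneg _) fun _ _ => (Real.exp_pos _).le)
  positivity

lemma abs_kernel_le {c x y s : ℝ} (hc : 0 < c) (hx : x ∈ Icc (0 : ℝ) 1) (hy : y ∈ Icc 0 x)
    (hs : |s| = |c * (x ^ 2 - y ^ 2) / 4|) :
    |-(c / 2) * x * besselSeries 1 s| ≤ c / 2 * Real.exp (c * (x ^ 2 - y ^ 2) / 4) := by
  have hxy : y ^ 2 ≤ x ^ 2 := pow_le_pow_left₀ hy.1 hy.2 2
  have hnn : 0 ≤ c * (x ^ 2 - y ^ 2) / 4 := by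
    have := sub_nonneg.mpr hxy
    positivity
  rw [abs_of_nonneg hnn] at hs
  have h := abs_besselSeries_le_exp 1 s
  rw [hs] at h
  rw [abs_mul, abs_mul, abs_neg, abs_of_pos (half_pos hc), abs_of_nonneg hx.1, mul_assoc]
  gcongr
  exact (mul_le_of_le_one_left (abs_nonneg _) hx.2).trans h

lemma kerNorm_Kker_le {c : ℝ} (hc : 0 < c) : kerNorm (Kker c) ≤
    √(c * Real.pi / 8) * erfi √(c / 2) ^ ((1 : ℝ) / 2) * erf √(c / 2) ^ ((1 : ℝ) / 2) :=
  kerNorm_le_erf_erfi hc (continuous_Kker c) fun x hx y hy => by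
    rw [Kker_eq]
    exact abs_kernel_le hc hx hy rfl

lemma kerNorm_Lker_le {c : ℝ} (hc : 0 < c) : kerNorm (Lker c) ≤
    √(c * Real.pi / 8) * erfi √(c / 2) ^ ((1 : ℝ) / 2) * erf √(c / 2) ^ ((1 : ℝ) / 2) :=
  kerNorm_le_erf_erfi hc (continuous_Lker c) fun x hx y hy => by
    rw [Lker_eq]
    exact abs_kernel_le hc hx hy (abs_neg _)

/-- The `x`-derivative of `Kker c`. -/
noncomputable def KkerDx (c x y : ℝ) : ℝ :=
  -(c / 2) * besselSeries 1 (c * (x ^ 2 - y ^ 2) / 4) -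
    c ^ 2 / 4 * x ^ 2 * besselSeries 2 (c * (x ^ 2 - y ^ 2) / 4)

/-- The second `x`-derivative of `Kker c`. -/
noncomputable def KkerDxx (c x y : ℝ) : ℝ :=
  -(3 * c ^ 2 / 4) * x * besselSeries 2 (c * (x ^ 2 - y ^ 2) / 4) -
    c ^ 3 / 8 * x ^ 3 * besselSeries 3 (c * (x ^ 2 - y ^ 2) / 4)

/-- The `y`-derivative of `Kker c`. -/
noncomputable def KkerDy (c x y : ℝ) : ℝ :=
  c ^ 2 / 4 * x * y * besselSeries 2 (c * (x ^ 2 - y ^ 2) / 4)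

/-- The second `y`-derivative of `Kker c`. -/
noncomputable def KkerDyy (c x y : ℝ) : ℝ :=
  c ^ 2 / 4 * x * besselSeries 2 (c * (x ^ 2 - y ^ 2) / 4) -
    c ^ 3 / 8 * x * y ^ 2 * besselSeries 3 (c * (x ^ 2 - y ^ 2) / 4)

lemma continuous_KkerDx (c : ℝ) : Continuous fun p : ℝ × ℝ => KkerDx c p.1 p.2 := by
  unfold KkerDx
  fun_prop

lemma continuous_KkerDxx (c : ℝ) : Continuous fun p : ℝ × ℝ => KkerDxx c p.1 p.2 := by
  unfold KkerDxx
  fun_prop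

lemma continuous_KkerDyy (c : ℝ) : Continuous fun p : ℝ × ℝ => KkerDyy c p.1 p.2 := by
  unfold KkerDyy
  fun_prop

lemma hasDerivAt_besselSeries_comp_left (k : ℕ) (c x y : ℝ) :
    HasDerivAt (fun x => besselSeries k (c * (x ^ 2 - y ^ 2) / 4))
      (c * x / 2 * besselSeries (k + 1) (c * (x ^ 2 - y ^ 2) / 4)) x := by
  have hs : HasDerivAt (fun x : ℝ => c * (x ^ 2 - y ^ 2) / 4) (c * x / 2) x := by
    refine ((((hasDerivAt_pow 2 x).sub_const (y ^ 2)).const_mul c).div_const 4).congr_deriv ?_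
    norm_num
    ring
  refine ((hasDerivAt_besselSeries k _).comp x hs).congr_deriv ?_
  ring

lemma hasDerivAt_besselSeries_comp_right (k : ℕ) (c x y : ℝ) :
    HasDerivAt (fun y => besselSeries k (c * (x ^ 2 - y ^ 2) / 4))
      (-(c * y / 2) * besselSeries (k + 1) (c * (x ^ 2 - y ^ 2) / 4)) y := by
  have hs : HasDerivAt (fun y : ℝ => c * (x ^ 2 - y ^ 2) / 4) (-(c * y / 2)) y := by
    refine ((((hasDerivAt_pow 2 y).const_sub (x ^ 2)).const_mul c).div_const 4).congr_deriv ?_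
    norm_num
    ring
  refine ((hasDerivAt_besselSeries k _).comp y hs).congr_deriv ?_
  ring

lemma hasDerivAt_Kker_left (c x y : ℝ) :
    HasDerivAt (fun x => Kker c x y) (KkerDx c x y) x := by
  refine (((hasDerivAt_id x).const_mul (-(c / 2))).mul
    (hasDerivAt_besselSeries_comp_left 1 c x y)).congr_deriv ?_
  simp only [KkerDx, id]
  ring

lemma hasDerivAt_KkerDx_left (c x y : ℝ) :
    HasDerivAt (fun x => KkerDx c x y) (KkerDxx c x y) x := by
  refine (((hasDerivAt_besselSeries_comp_left 1 c x y).const_mul (-(c / 2))).sub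
    (((hasDerivAt_pow 2 x).const_mul (c ^ 2 / 4)).mul
      (hasDerivAt_besselSeries_comp_left 2 c x y))).congr_deriv ?_
  simp only [KkerDxx]
  norm_num
  ring

lemma hasDerivAt_Kker_right (c x y : ℝ) :
    HasDerivAt (fun y => Kker c x y) (KkerDy c x y) y := by
  refine ((hasDerivAt_besselSeries_comp_right 1 c x y).const_mul (-(c / 2) * x)).congr_deriv ?_
  simp only [KkerDy]
  ring

lemma hasDerivAt_KkerDy_right (c x y : ℝ) :
    HasDerivAt (fun y => KkerDy c x y) (KkerDyy c x y) y := by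
  refine (((hasDerivAt_id y).const_mul (c ^ 2 / 4 * x)).mul
    (hasDerivAt_besselSeries_comp_right 2 c x y)).congr_deriv ?_
  simp only [KkerDyy, id]
  ring

/-- The Klein–Gordon type equation of the backstepping kernel. -/
lemma KkerDxx_eq (c x y : ℝ) : KkerDxx c x y = KkerDyy c x y + c * Kker c x y := by
  have h := besselSeries_recurrence 1 (c * (x ^ 2 - y ^ 2) / 4)
  norm_num at h
  rw [KkerDxx, KkerDyy, Kker_eq, ← h]
  ring

lemma Kker_diag (c x : ℝ) : Kker c x x = -(c / 2) * x := by
  simp [Kker_eq, besselSeries_one_zero]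

lemma KkerDx_diag (c x : ℝ) : KkerDx c x x = -(c / 2) - KkerDy c x x := by
  simp only [KkerDx, KkerDy, sub_self, mul_zero, zero_div, besselSeries_one_zero]
  ring

lemma hasDerivAt_backstepping {c : ℝ} {f f' : ℝ → ℝ} (hf : ∀ x, HasDerivAt f (f' x) x) (x : ℝ) :
    HasDerivAt (fun x => f x - ∫ y in (0 : ℝ)..x, Kker c x y * f y)
      (f' x - (Kker c x x * f x + ∫ y in (0 : ℝ)..x, KkerDx c x y * f y)) x := by
  have hfc : Continuous f := continuous_iff_continuousAt.mpr fun x => (hf x).continuousAt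
  exact (hf x).sub (hasDerivAt_integral_upper (F := fun x y => Kker c x y * f y)
    (F' := fun x y => KkerDx c x y * f y)
    ((continuous_Kker c).mul (hfc.comp continuous_snd))
    ((continuous_KkerDx c).mul (hfc.comp continuous_snd))
    (fun x y => (hasDerivAt_Kker_left c x y).mul_const (f y)) x)

/-- The backstepping transformation intertwines `∂ₓ²` with `∂ₓ² - c`. -/
lemma hasDerivAt_deriv_backstepping {c : ℝ} {f f' f'' : ℝ → ℝ} (hf : ∀ x, HasDerivAt f (f' x) x)
    (hf' : ∀ x, HasDerivAt f' (f'' x) x) (hf'' : Continuous f'') (h0 : f' 0 = 0) (x : ℝ) :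
    HasDerivAt (fun x => f' x - (Kker c x x * f x + ∫ y in (0 : ℝ)..x, KkerDx c x y * f y))
      ((f'' x - ∫ y in (0 : ℝ)..x, Kker c x y * f'' y) +
        c * (f x - ∫ y in (0 : ℝ)..x, Kker c x y * f y)) x := by
  have hfc : Continuous f := continuous_iff_continuousAt.mpr fun x => (hf x).continuousAt
  have hslice : ∀ {k : ℝ → ℝ → ℝ}, (Continuous fun p : ℝ × ℝ => k p.1 p.2) →
      Continuous (k x) := fun hk => hk.comp (by fun_prop : Continuous fun y => (x, y))
  have hK := hslice (continuous_Kker c)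
  have hKyy := hslice (continuous_KkerDyy c)
  have hdiag : HasDerivAt (fun x => Kker c x x * f x) (-(c / 2) * f x + Kker c x x * f' x) x := by
    simp only [Kker_diag]
    refine (((hasDerivAt_id x).const_mul (-(c / 2))).mul (hf x)).congr_deriv ?_
    simp only [id, mul_one]
  have hupper := hasDerivAt_integral_upper (F := fun x y => KkerDx c x y * f y)
    (F' := fun x y => KkerDxx c x y * f y)
    ((continuous_KkerDx c).mul (hfc.comp continuous_snd))
    ((continuous_KkerDxx c).mul (hfc.comp continuous_snd))
    (fun x y => (hasDerivAt_KkerDx_left c x y).mul_const (f y)) x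
  have hparts : ∫ y in (0 : ℝ)..x, (Kker c x y * f'' y - KkerDyy c x y * f y) =
      Kker c x x * f' x - KkerDy c x x * f x := by
    have h := integral_eq_sub_of_hasDerivAt (a := 0) (b := x)
      (f := fun y => Kker c x y * f' y - KkerDy c x y * f y)
      (f' := fun y => Kker c x y * f'' y - KkerDyy c x y * f y)
      (fun y _ => by
        refine (((hasDerivAt_Kker_right c x y).mul (hf' y)).sub
          ((hasDerivAt_KkerDy_right c x y).mul (hf y))).congr_deriv ?_
        ring)
      (((hK.mul hf'').sub (hKyy.mul hfc)).intervalIntegrable _ _)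
    rw [h, h0]
    simp [KkerDy]
  rw [intervalIntegral.integral_sub (Continuous.intervalIntegrable (by fun_prop) _ _)
    (Continuous.intervalIntegrable (by fun_prop) _ _)] at hparts
  have hxx : ∫ y in (0 : ℝ)..x, KkerDxx c x y * f y =
      (∫ y in (0 : ℝ)..x, KkerDyy c x y * f y) + c * ∫ y in (0 : ℝ)..x, Kker c x y * f y := by
    rw [← intervalIntegral.integral_const_mul, ← intervalIntegral.integral_add
      (Continuous.intervalIntegrable (by fun_prop) _ _)
      (Continuous.intervalIntegrable (by fun_prop) _ _)]
    refine integral_congr fun y _ => ?_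
    simp only [KkerDxx_eq]
    ring
  refine ((hf' x).sub (hdiag.add hupper)).congr_deriv ?_
  rw [hxx, KkerDx_diag]
  linarith

/-- The backstepping transformation `f ↦ f - ∫₀ˣ K_c(x, y) f(y) dy`. -/
noncomputable def backstep (c : ℝ) (f : ℝ → ℝ) (x : ℝ) : ℝ :=
  f x - ∫ y in (0 : ℝ)..x, Kker c x y * f y

@[fun_prop]
lemma continuous_backstep {c : ℝ} {f : ℝ → ℝ} (hf : Continuous f) : Continuous (backstep c f) :=
  hf.sub (continuous_volterra (continuous_Kker c) hf)

lemma unitNorm_backstep_le {c : ℝ} {f : ℝ → ℝ} (hf : Continuous f) :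
    unitNorm (backstep c f) ≤ (1 + kerNorm (Kker c)) * unitNorm f := by
  have h := unitNorm_sub_le hf (continuous_volterra (continuous_Kker c) hf)
  have h2 := unitNorm_volterra_le (continuous_Kker c) hf
  unfold backstep
  linarith

lemma unitNorm_le_backstep {c : ℝ} {f : ℝ → ℝ} (hf : Continuous f) :
    unitNorm f ≤ (1 + kerNorm (Lker c)) * unitNorm (backstep c f) := by
  have hb : Continuous (backstep c f) := continuous_backstep hf
  have h := unitNorm_add_le hb (continuous_volterra (continuous_Lker c) hb)
  have h2 := unitNorm_volterra_le (continuous_Lker c) hb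
  have heq : f = fun x => backstep c f x + ∫ y in (0 : ℝ)..x, Lker c x y * backstep c f y :=
    funext fun x => inverse_backstepping c hf x
  rw [← heq] at h
  linarith

lemma backstep_linear_combination {c r a x : ℝ} {f g h : ℝ → ℝ} (hf : Continuous f)
    (hg : Continuous g) (hh : Continuous h) :
    backstep c (fun x => f x - r * g x + a * h x) x =
      backstep c f x - r * backstep c g x + a * backstep c h x := by
  have hK : Continuous (Kker c x) :=
    (continuous_Kker c).comp (by fun_prop : Continuous fun y => (x, y))
  have heq : ∫ y in (0 : ℝ)..x, Kker c x y * (f y - r * g y + a * h y) =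
      ∫ y in (0 : ℝ)..x,
        (Kker c x y * f y - r * (Kker c x y * g y) + a * (Kker c x y * h y)) :=
    integral_congr fun y _ => by ring
  simp only [backstep]
  rw [heq, intervalIntegral.integral_add (Continuous.intervalIntegrable (by fun_prop) _ _)
    (Continuous.intervalIntegrable (by fun_prop) _ _),
    intervalIntegral.integral_sub (Continuous.intervalIntegrable (by fun_prop) _ _)
    (Continuous.intervalIntegrable (by fun_prop) _ _), intervalIntegral.integral_const_mul,
    intervalIntegral.integral_const_mul]
  ring

lemma integral_mul_deriv_deriv_nonpos {f f' f'' : ℝ → ℝ} (hf : ∀ x, HasDerivAt f (f' x) x)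
    (hf' : ∀ x, HasDerivAt f' (f'' x) x) (hf'' : Continuous f'') (h0 : f' 0 = 0) (h1 : f' 1 = 0) :
    ∫ x in (0 : ℝ)..1, f x * f'' x ≤ 0 := by
  have hf'c : Continuous f' := continuous_iff_continuousAt.mpr fun x => (hf' x).continuousAt
  rw [integral_mul_deriv_eq_deriv_mul (fun x _ => hf x) (fun x _ => hf' x)
    (hf'c.intervalIntegrable _ _) (hf''.intervalIntegrable _ _), h0, h1]
  have : 0 ≤ ∫ x in (0 : ℝ)..1, f' x * f' x :=
    integral_nonneg zero_le_one fun x _ => mul_self_nonneg _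
  linarith

/-- The a priori bound for the Neumann problem `f'' - γ f + β g = 0`. -/
lemma unitNorm_le_of_elliptic {γ β : ℝ} (hγ : 0 < γ) {f f' f'' g : ℝ → ℝ}
    (hf : ∀ x, HasDerivAt f (f' x) x) (hf' : ∀ x, HasDerivAt f' (f'' x) x)
    (hf'' : Continuous f'') (hg : Continuous g) (h0 : f' 0 = 0) (h1 : f' 1 = 0)
    (heq : ∀ x ∈ Icc (0 : ℝ) 1, 0 = f'' x - γ * f x + β * g x) :
    unitNorm f ≤ |β| / γ * unitNorm g := by
  have hfc : Continuous f := continuous_iff_continuousAt.mpr fun x => (hf x).continuousAt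
  have hnp := integral_mul_deriv_deriv_nonpos hf hf' hf'' h0 h1
  have hsq : γ * unitNorm f ^ 2 =
      (∫ x in (0 : ℝ)..1, f x * f'' x) + β * ∫ x in (0 : ℝ)..1, f x * g x := by
    rw [sq_unitNorm, ← intervalIntegral.integral_const_mul, ← intervalIntegral.integral_const_mul,
      ← intervalIntegral.integral_add (Continuous.intervalIntegrable (by fun_prop) _ _)
      (Continuous.intervalIntegrable (by fun_prop) _ _)]
    refine integral_congr fun x hx => ?_
    rw [uIcc_of_le zero_le_one] at hx
    linear_combination (f x) * heq x hx
  have hcs : β * ∫ x in (0 : ℝ)..1, f x * g x ≤ |β| * (unitNorm f * unitNorm g) := by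
    refine (le_abs_self _).trans ?_
    rw [abs_mul]
    gcongr
    exact abs_integral_mul_le_unitNorm hfc hg
  rcases (unitNorm_nonneg f).eq_or_lt with hz | hpos
  · rw [← hz]
    exact mul_nonneg (by positivity) (unitNorm_nonneg g)
  · rw [div_mul_eq_mul_div, le_div_iff₀ hγ]
    refine le_of_mul_le_mul_left ?_ hpos
    linarith

/-- The dissipation inequality for the transformed state. -/
lemma integral_backstep_mul_le {ρ α β γ c : ℝ} (hγ : 0 < γ)
    {f f' f'' g g' g'' : ℝ → ℝ}
    (hf : ∀ x, HasDerivAt f (f' x) x) (hf' : ∀ x, HasDerivAt f' (f'' x) x)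
    (hf'' : Continuous f'')
    (hg : ∀ x, HasDerivAt g (g' x) x) (hg' : ∀ x, HasDerivAt g' (g'' x) x)
    (hg'' : Continuous g'')
    (hell : ∀ x ∈ Icc (0 : ℝ) 1, 0 = g'' x - γ * g x + β * f x)
    (hf0 : f' 0 = 0)
    (hf1 : f' 1 = (∫ y in (0 : ℝ)..1, KkerDx c 1 y * f y) + Kker c 1 1 * f 1)
    (hg0 : g' 0 = 0) (hg1 : g' 1 = 0) :
    ∫ x in (0 : ℝ)..1, backstep c f x * backstep c (fun x => f'' x - ρ * f x + α * g x) x ≤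
      -((c + ρ) - (|α * β| / γ) * (1 + kerNorm (Lker c)) * (1 + kerNorm (Kker c))) *
        unitNorm (backstep c f) ^ 2 := by
  have hfc : Continuous f := continuous_iff_continuousAt.mpr fun x => (hf x).continuousAt
  have hgc : Continuous g := continuous_iff_continuousAt.mpr fun x => (hg x).continuousAt
  set z := backstep c f with hz
  have hzc : Continuous z := continuous_backstep hfc
  have hbf : Continuous (backstep c f'') := continuous_backstep hf''
  have hbg : Continuous (backstep c g) := continuous_backstep hgc
  have hnp : ∫ x in (0 : ℝ)..1, z x * (backstep c f'' x + c * z x) ≤ 0 := by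
    refine integral_mul_deriv_deriv_nonpos (hasDerivAt_backstepping hf)
      (hasDerivAt_deriv_backstepping hf hf' hf'' hf0) (by fun_prop) ?_ ?_
    · simp [hf0, Kker_diag]
    · rw [hf1]
      ring
  have hsplit : ∫ x in (0 : ℝ)..1,
      z x * backstep c (fun x => f'' x - ρ * f x + α * g x) x =
      (∫ x in (0 : ℝ)..1, z x * (backstep c f'' x + c * z x)) - (c + ρ) * unitNorm z ^ 2 +
        α * ∫ x in (0 : ℝ)..1, z x * backstep c g x := by
    rw [sq_unitNorm, ← intervalIntegral.integral_const_mul, ← intervalIntegral.integral_const_mul,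
      ← intervalIntegral.integral_sub (Continuous.intervalIntegrable (by fun_prop) _ _)
      (Continuous.intervalIntegrable (by fun_prop) _ _),
      ← intervalIntegral.integral_add (Continuous.intervalIntegrable (by fun_prop) _ _)
      (Continuous.intervalIntegrable (by fun_prop) _ _)]
    refine integral_congr fun x _ => ?_
    simp only [backstep_linear_combination hf'' hfc hgc, ← hz]
    ring
  have hKn := kerNorm_nonneg (Kker c)
  have hcs : α * ∫ x in (0 : ℝ)..1, z x * backstep c g x ≤
      (|α * β| / γ) * (1 + kerNorm (Lker c)) * (1 + kerNorm (Kker c)) * unitNorm z ^ 2 := by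
    have hzn := unitNorm_nonneg z
    calc α * ∫ x in (0 : ℝ)..1, z x * backstep c g x
        ≤ |α| * |∫ x in (0 : ℝ)..1, z x * backstep c g x| := by
          rw [← abs_mul]
          exact le_abs_self _
      _ ≤ |α| * (unitNorm z * unitNorm (backstep c g)) := by
          gcongr
          exact abs_integral_mul_le_unitNorm hzc hbg
      _ ≤ |α| * (unitNorm z * ((1 + kerNorm (Kker c)) * unitNorm g)) := by
          gcongr
          exact unitNorm_backstep_le hgc
      _ ≤ |α| * (unitNorm z * ((1 + kerNorm (Kker c)) * (|β| / γ * unitNorm f))) := by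
          gcongr
          exact unitNorm_le_of_elliptic hγ hg hg' hg'' hfc hg0 hg1 hell
      _ ≤ |α| * (unitNorm z * ((1 + kerNorm (Kker c)) *
            (|β| / γ * ((1 + kerNorm (Lker c)) * unitNorm z)))) := by
          gcongr
          exact unitNorm_le_backstep hfc
      _ = _ := by
          rw [abs_mul]
          ring
  rw [hsplit]
  linarith

/-- Grönwall's inequality on the half-line for a continuous energy. -/
lemma le_exp_mul_of_deriv_le {E E' : ℝ → ℝ} {c : ℝ} (hE : ContinuousOn E (Ici 0))
    (hd : ∀ t, 0 < t → HasDerivAt E (E' t) t) (hle : ∀ t, 0 < t → E' t ≤ -2 * c * E t) {t : ℝ}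
    (ht : 0 ≤ t) : E t ≤ Real.exp (-2 * c * t) * E 0 := by
  have hexp : ∀ t : ℝ, HasDerivAt (fun t => Real.exp (2 * c * t))
      (Real.exp (2 * c * t) * (2 * c)) t :=
    fun t => ((hasDerivAt_id t).const_mul (2 * c)).exp.congr_deriv (by simp)
  have hder : ∀ t ∈ interior (Ici (0 : ℝ)), HasDerivAt (fun t => Real.exp (2 * c * t) * E t)
      (Real.exp (2 * c * t) * (2 * c) * E t + Real.exp (2 * c * t) * E' t) t := fun t ht =>
    (hexp t).mul (hd t (by simpa using ht))
  have hanti : AntitoneOn (fun t => Real.exp (2 * c * t) * E t) (Ici 0) := by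
    refine antitoneOn_of_deriv_nonpos (convex_Ici 0) (ContinuousOn.mul (by fun_prop) hE)
      (fun t ht => (hder t ht).differentiableAt.differentiableWithinAt) fun t ht => ?_
    rw [(hder t ht).deriv]
    have := mul_le_mul_of_nonneg_left (hle t (by simpa using ht)) (Real.exp_pos (2 * c * t)).le
    linarith
  have h := hanti self_mem_Ici (mem_Ici.mpr ht) ht
  simp only [mul_zero, Real.exp_zero, one_mul] at h
  calc E t = Real.exp (-2 * c * t) * (Real.exp (2 * c * t) * E t) := by
        rw [← mul_assoc, ← Real.exp_add]
        simp
    _ ≤ _ := mul_le_mul_of_nonneg_left h (Real.exp_pos _).le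

end

/-- the main stabilization theorem.  Under the erf–erfi bound on
`c₂ + ρ`, the Neumann feedback `u(t) = ∫₀¹ K_x(1,y)w(y,t)dy + K(1,1)w(1,t)`
renders the closed-loop coupled parabolic–elliptic system exponentially stable. -/
theorem closed_loop_exponential_stability (ρ α β γ c₂ : ℝ) (hγ : γ > 0) (hc₂ : c₂ > 0)
    (hcond : c₂ + ρ > (|α * β| / γ) *
      (1 + Real.sqrt (c₂ * Real.pi / 8) *
        (erfi (Real.sqrt (c₂ / 2))) ^ ((1:ℝ)/2) *
        (erf (Real.sqrt (c₂ / 2))) ^ ((1:ℝ)/2)) ^ 2)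
    (w v : ℝ → ℝ → ℝ)
    -- regularity of the classical solution
    (hw_cont : Continuous fun p : ℝ × ℝ => w p.1 p.2)
    (hv_cont : Continuous fun p : ℝ × ℝ => v p.1 p.2)
    (hw_x : ∀ t : ℝ, ContDiff ℝ 2 fun x => w x t)
    (hv_x : ∀ t : ℝ, ContDiff ℝ 2 fun x => v x t)
    (hwx_cont : Continuous fun p : ℝ × ℝ => deriv (fun x => w x p.2) p.1)
    (hwxx_cont : Continuous fun p : ℝ × ℝ => deriv (deriv (fun x => w x p.2)) p.1)
    (hvx_cont : Continuous fun p : ℝ × ℝ => deriv (fun x => v x p.2) p.1)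
    (hvxx_cont : Continuous fun p : ℝ × ℝ => deriv (deriv (fun x => v x p.2)) p.1)
    (hw_t : ∀ x : ℝ, ContDiff ℝ 1 fun t => w x t)
    -- the closed-loop coupled parabolic–elliptic system
    (hpde : ∀ x ∈ Set.Icc (0:ℝ) 1, ∀ t : ℝ, 0 ≤ t →
      deriv (fun τ => w x τ) t =
        deriv (deriv (fun ξ => w ξ t)) x - ρ * w x t + α * v x t)
    (hell : ∀ x ∈ Set.Icc (0:ℝ) 1, ∀ t : ℝ, 0 ≤ t →
      (0 : ℝ) = deriv (deriv (fun ξ => v ξ t)) x - γ * v x t + β * w x t)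
    (hbc0 : ∀ t : ℝ, 0 ≤ t → deriv (fun ξ => w ξ t) 0 = 0)
    (hbc1 : ∀ t : ℝ, 0 ≤ t → deriv (fun ξ => w ξ t) 1 =
      (∫ y in (0:ℝ)..1, deriv (fun ξ => Kker c₂ ξ y) 1 * w y t) +
        Kker c₂ 1 1 * w 1 t)
    (hbv0 : ∀ t : ℝ, 0 ≤ t → deriv (fun ξ => v ξ t) 0 = 0)
    (hbv1 : ∀ t : ℝ, 0 ≤ t → deriv (fun ξ => v ξ t) 1 = 0)
    (c₃ : ℝ)
    (hc₃ : c₃ = (c₂ + ρ) -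
      (|α * β| / γ) * (1 + kerNorm (Lker c₂)) * (1 + kerNorm (Kker c₂))) :
    c₃ > 0 ∧
    ∀ t : ℝ, 0 ≤ t →
      (∫ x in (0:ℝ)..1, (w x t) ^ 2) ≤
        (1 + kerNorm (Lker c₂)) ^ 2 * (1 + kerNorm (Kker c₂)) ^ 2 *
          (Real.exp (-2 * c₃ * t) * ∫ x in (0:ℝ)..1, (w x 0) ^ 2) := by
  have hK0 := kerNorm_nonneg (Kker c₂)
  have hL0 := kerNorm_nonneg (Lker c₂)
  have hpos : c₃ > 0 := by
    have hprod : (1 + kerNorm (Lker c₂)) * (1 + kerNorm (Kker c₂)) ≤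
        (1 + Real.sqrt (c₂ * Real.pi / 8) * (erfi (Real.sqrt (c₂ / 2))) ^ ((1:ℝ)/2) *
          (erf (Real.sqrt (c₂ / 2))) ^ ((1:ℝ)/2)) ^ 2 := by
      have hKle := kerNorm_Kker_le hc₂
      have hLle := kerNorm_Lker_le hc₂
      rw [sq]
      exact mul_le_mul (by linarith) (by linarith) (by linarith) (by linarith)
    have := mul_le_mul_of_nonneg_left hprod (by positivity : 0 ≤ |α * β| / γ)
    rw [hc₃, mul_assoc]
    linarith
  refine ⟨hpos, fun t ht => ?_⟩
  have hwd : ∀ t x, HasDerivAt (fun x => w x t) (deriv (fun ξ => w ξ t) x) x := fun t x =>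
    ((hw_x t).differentiable (by norm_num) x).hasDerivAt
  have hvd : ∀ t x, HasDerivAt (fun x => v x t) (deriv (fun ξ => v ξ t) x) x := fun t x =>
    ((hv_x t).differentiable (by norm_num) x).hasDerivAt
  have hwdd : ∀ t x, HasDerivAt (fun x => deriv (fun ξ => w ξ t) x)
      (deriv (deriv (fun ξ => w ξ t)) x) x := fun t x =>
    ((hw_x t).differentiable_deriv_two x).hasDerivAt
  have hvdd : ∀ t x, HasDerivAt (fun x => deriv (fun ξ => v ξ t) x)
      (deriv (deriv (fun ξ => v ξ t)) x) x := fun t x =>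
    ((hv_x t).differentiable_deriv_two x).hasDerivAt
  have hwslice : ∀ t, Continuous fun x => w x t := fun t => (hw_x t).continuous
  set g : ℝ → ℝ → ℝ := fun t x =>
    deriv (deriv (fun ξ => w ξ t)) x - ρ * w x t + α * v x t with hg
  have hswap : Continuous fun p : ℝ × ℝ => (p.2, p.1) := by fun_prop
  have hgc : Continuous fun p : ℝ × ℝ => g p.1 p.2 :=
    ((hwxx_cont.comp hswap).sub ((hw_cont.comp hswap).const_mul ρ)).add
      ((hv_cont.comp hswap).const_mul α)
  have hw_cont' : Continuous fun p : ℝ × ℝ => w p.2 p.1 := hw_cont.comp hswap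
  have hjoint : ∀ {h : ℝ → ℝ → ℝ}, (Continuous fun p : ℝ × ℝ => h p.1 p.2) →
      Continuous fun p : ℝ × ℝ => backstep c₂ (h p.1) p.2 := by
    intro h hh
    refine hh.sub (intervalIntegral.continuous_parametric_intervalIntegral_of_continuous
      (f := fun (p : ℝ × ℝ) y => Kker c₂ p.2 y * h p.1 y) ?_ continuous_snd)
    exact ((continuous_Kker c₂).comp
      (by fun_prop : Continuous fun q : (ℝ × ℝ) × ℝ => (q.1.2, q.2))).mul
      (hh.comp (by fun_prop : Continuous fun q : (ℝ × ℝ) × ℝ => (q.1.1, q.2)))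
  have hz := hjoint (h := fun t x => w x t) hw_cont'
  have hzg := hjoint hgc
  have hwt : ∀ x ∈ Set.Icc (0:ℝ) 1, ∀ t ∈ Set.Ioi (0:ℝ),
      HasDerivAt (fun τ => w x τ) (g t x) t := fun x hx t ht =>
    ((hw_t x).differentiable one_ne_zero t).hasDerivAt.congr_deriv (hpde x hx t (le_of_lt ht))
  have hzt : ∀ x ∈ Set.Icc (0:ℝ) 1, ∀ t ∈ Set.Ioi (0:ℝ),
      HasDerivAt (fun τ => backstep c₂ (fun ξ => w ξ τ) x) (backstep c₂ (g t) x) t := by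
    intro x hx t ht
    have hKx : Continuous fun p : ℝ × ℝ => Kker c₂ x p.2 :=
      (continuous_Kker c₂).comp (by fun_prop : Continuous fun p : ℝ × ℝ => (x, p.2))
    refine (hwt x hx t ht).sub (hasDerivAt_integral_of_continuous
      (F := fun τ y => Kker c₂ x y * w y τ) (F' := fun τ y => Kker c₂ x y * g τ y)
      (isOpen_Ioi.mem_nhds ht) (hKx.mul hw_cont') (hKx.mul hgc) fun y hy τ hτ => ?_)
    rw [Set.uIcc_of_le hx.1] at hy
    exact (hwt y ⟨hy.1, hy.2.trans hx.2⟩ τ hτ).const_mul _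
  have hE : Continuous fun t => ∫ x in (0:ℝ)..1, backstep c₂ (fun ξ => w ξ t) x ^ 2 :=
    intervalIntegral.continuous_parametric_intervalIntegral_of_continuous'
      (f := fun t x => backstep c₂ (fun ξ => w ξ t) x ^ 2) (hz.fun_pow 2) 0 1
  have hEd : ∀ t, 0 < t → HasDerivAt
      (fun t => ∫ x in (0:ℝ)..1, backstep c₂ (fun ξ => w ξ t) x ^ 2)
      (∫ x in (0:ℝ)..1, 2 * (backstep c₂ (fun ξ => w ξ t) x * backstep c₂ (g t) x)) t := by
    intro t ht
    refine hasDerivAt_integral_of_continuous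
      (F := fun t x => backstep c₂ (fun ξ => w ξ t) x ^ 2)
      (F' := fun t x => 2 * (backstep c₂ (fun ξ => w ξ t) x * backstep c₂ (g t) x))
      (Ioi_mem_nhds ht) (hz.fun_pow 2) ((hz.mul hzg).const_mul 2) fun x hx τ hτ => ?_
    rw [Set.uIcc_of_le zero_le_one] at hx
    refine ((hzt x hx τ hτ).fun_pow 2).congr_deriv ?_
    norm_num
    ring
  have hdecay := le_exp_mul_of_deriv_le hE.continuousOn hEd (c := c₃) (fun t ht => by
    have hKx : ∀ y, deriv (fun ξ => Kker c₂ ξ y) 1 = KkerDx c₂ 1 y := fun y =>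
      (hasDerivAt_Kker_left c₂ 1 y).deriv
    have hb1 := hbc1 t ht.le
    simp only [hKx] at hb1
    have h := integral_backstep_mul_le (ρ := ρ) (α := α) hγ (hwd t) (hwdd t)
      (hwxx_cont.comp (by fun_prop : Continuous fun x : ℝ => (x, t))) (hvd t) (hvdd t)
      (hvxx_cont.comp (by fun_prop : Continuous fun x : ℝ => (x, t)))
      (fun x hx => hell x hx t ht.le) (hbc0 t ht.le) hb1 (hbv0 t ht.le) (hbv1 t ht.le)
    rw [← hc₃, sq_unitNorm] at h
    rw [intervalIntegral.integral_const_mul]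
    linarith) ht
  rw [← sq_unitNorm, ← sq_unitNorm] at hdecay
  rw [← sq_unitNorm (fun x => w x t), ← sq_unitNorm (fun x => w x 0)]
  have h1 := pow_le_pow_left₀ (unitNorm_nonneg _) (unitNorm_le_backstep (c := c₂) (hwslice t)) 2
  have h2 := pow_le_pow_left₀ (unitNorm_nonneg _) (unitNorm_backstep_le (c := c₂) (hwslice 0)) 2
  rw [mul_pow] at h1 h2
  calc unitNorm (fun x => w x t) ^ 2
      ≤ (1 + kerNorm (Lker c₂)) ^ 2 * unitNorm (backstep c₂ fun x => w x t) ^ 2 := h1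
    _ ≤ (1 + kerNorm (Lker c₂)) ^ 2 * (Real.exp (-2 * c₃ * t) *
          ((1 + kerNorm (Kker c₂)) ^ 2 * unitNorm (fun x => w x 0) ^ 2)) := by
        gcongr
        exact hdecay.trans (mul_le_mul_of_nonneg_left h2 (Real.exp_pos _).le)
    _ = _ := by ring
end
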